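/- arXiv:1404.7226 — 3 statements merged into one kernel-verified Lean document; each statement's English description precedes it below -/
import Mathlib

section
/- Let V be a real inner product space with a linear map φ : V → V, a vector ξ ∈ V, and η(X) = ⟨X, ξ⟩ satisfying φ²X = −X + η(X)ξ, φξ = 0, η(φX) = 0, η(ξ) = 1, and ⟨φX, φY⟩ = ⟨X, Y⟩ − η(X)η(Y) for all X, Y ∈ V. Let T ⊆ V be a subspace with ξ ∈ T, and for X ∈ T let PX be the orthogonal projection of φX onto T. Suppose there is a constant λ ∈ [0, 1] with P(PX) = λ(−X + η(X)ξ) for every X ∈ T. Then for every X ∈ T the norms satisfy ‖PX‖² = λ(‖X‖² − η(X)²) = λ‖φX‖²; in particular, for every X ∈ T that is not a scalar multiple of ξ one has φX ≠ 0 and ‖PX‖/‖φX‖ = √λ, so the cosine of the Wirtinger angle θ(X) between φX and T is the constant √λ, independent of X. -/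
open scoped RealInnerProductSpace

/-- The quantitative content of Theorem 2.1 (`λ = cos² θ`): on a slant tangent space
`T` (with `ξ ∈ T`) with `P² = λ(-I + η ⊗ ξ)` on `T`, one has
`‖P X‖² = λ(‖X‖² - η(X)²) = λ ‖φ X‖²` for every `X ∈ T`; in particular, for `X ∈ T`
not proportional to `ξ`, `φ X ≠ 0` and the Wirtinger angle `θ(X)` between `φ X` and
`T` has constant cosine `‖P X‖ / ‖φ X‖ = √λ`. -/
theorem slant_wirtinger_angle_constant
    {V : Type*} [NormedAddCommGroup V] [InnerProductSpace ℝ V]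
    (φ : V →ₗ[ℝ] V) (ξ : V) (η : V → ℝ)
    (hη : ∀ X, η X = ⟪X, ξ⟫)
    (hφ2 : ∀ X, φ (φ X) = -X + η X • ξ)
    (hφξ : φ ξ = 0)
    (hηφ : ∀ X, η (φ X) = 0)
    (hηξ : η ξ = 1)
    (hmetric : ∀ X Y, ⟪φ X, φ Y⟫ = ⟪X, Y⟫ - η X * η Y)
    (T : Submodule ℝ V) (hξT : ξ ∈ T)
    -- `P X` is the orthogonal projection of `φ X` onto `T`, for `X ∈ T`:
    (P : V → V)
    (hPmem : ∀ X ∈ T, P X ∈ T)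
    (hPorth : ∀ X ∈ T, φ X - P X ∈ Tᗮ)
    (l : ℝ) (hl : l ∈ Set.Icc (0 : ℝ) 1)
    (hslant : ∀ X ∈ T, P (P X) = l • (-X + η X • ξ)) :
    (∀ X ∈ T, ‖P X‖ ^ 2 = l * (‖X‖ ^ 2 - (η X) ^ 2) ∧ ‖P X‖ ^ 2 = l * ‖φ X‖ ^ 2) ∧
    (∀ X ∈ T, (¬ ∃ c : ℝ, X = c • ξ) → φ X ≠ 0 ∧ ‖P X‖ / ‖φ X‖ = Real.sqrt l) := by
  have hT : ∀ X ∈ T, ∀ Y ∈ T, ⟪Y, P X⟫ = ⟪Y, φ X⟫ := by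
    intro X hX Y hY
    have h := (Submodule.mem_orthogonal T _).1 (hPorth X hX) Y hY
    rw [inner_sub_right] at h
    linarith
  have hskew : ∀ X Z, ⟪φ X, Z⟫ = -⟪X, φ Z⟫ := by
    intro X Z
    have h := hmetric X (φ Z)
    have h0 := hηφ X
    rw [hη] at h0
    rw [hφ2, hηφ, inner_add_right, inner_neg_right, inner_smul_right, h0] at h
    linarith
  have hφn : ∀ X, ‖φ X‖ ^ 2 = ‖X‖ ^ 2 - (η X) ^ 2 := by
    intro X
    have h := hmetric X X
    rw [real_inner_self_eq_norm_sq, real_inner_self_eq_norm_sq] at h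
    rw [h]; ring
  have hPn : ∀ X ∈ T, ‖P X‖ ^ 2 = l * (‖X‖ ^ 2 - (η X) ^ 2) := by
    intro X hX
    have h1 := hT X hX (P X) (hPmem X hX)
    have h2 := hskew X (P X)
    have h3 := hT (P X) (hPmem X hX) X hX
    rw [hslant X hX, inner_smul_right, inner_add_right, inner_neg_right, inner_smul_right,
      ← hη, real_inner_self_eq_norm_sq] at h3
    rw [real_inner_self_eq_norm_sq, real_inner_comm] at h1
    rw [h1, h2, ← h3]; ring
  refine ⟨fun X hX => ⟨hPn X hX, by rw [hφn, hPn X hX]⟩, fun X hX hne => ?_⟩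
  have hφ0 : φ X ≠ 0 := by
    intro h
    apply hne
    refine ⟨η X, ?_⟩
    have h2 := hφ2 X
    rw [h, map_zero] at h2
    exact (neg_add_eq_zero.1 h2.symm)
  refine ⟨hφ0, ?_⟩
  have hpos : 0 < ‖φ X‖ := norm_pos_iff.2 hφ0
  symm
  rw [Real.sqrt_eq_iff_mul_self_eq hl.1 (by positivity), ← pow_two, div_pow, hPn X hX, ← hφn]
  field_simp
end

section
/- Let n₁, n₂, k be natural numbers, n = n₁ + n₂, and for each r = 1, …, k let h^r be a symmetric n × n real matrix satisfying Σ_{i=1}^{n₁} h^r_{ii} = 0. Then Σ_{r=1}^{k} Σ_{i=1}^{n₁} Σ_{j=n₁+1}^{n} ( h^r_{ii} h^r_{jj} − (h^r_{ij})² ) = − Σ_{r=1}^{k} Σ_{i=1}^{n₁} Σ_{j=n₁+1}^{n} (h^r_{ij})² ≥ −(1/2) Σ_{r=1}^{k} Σ_{i=1}^{n} Σ_{j=1}^{n} (h^r_{ij})², and equality holds in the inequality if and only if h^r_{ik} = 0 for all 1 ≤ i, k ≤ n₁ and h^r_{jt} = 0 for all n₁ + 1 ≤ j, t ≤ n, for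 every r. -/
open Finset

lemma block_split (n₁ n₂ : ℕ) (M : Matrix (Fin (n₁ + n₂)) (Fin (n₁ + n₂)) ℝ) (hM : M.IsSymm) :
    ∑ i : Fin (n₁ + n₂), ∑ j : Fin (n₁ + n₂), (M i j) ^ 2 =
      2 * (∑ i ∈ Finset.univ.filter (fun i : Fin (n₁ + n₂) => (i : ℕ) < n₁),
        ∑ j ∈ Finset.univ.filter (fun j : Fin (n₁ + n₂) => n₁ ≤ (j : ℕ)), (M i j) ^ 2) +
      ((∑ i ∈ Finset.univ.filter (fun i : Fin (n₁ + n₂) => (i : ℕ) < n₁),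
        ∑ j ∈ Finset.univ.filter (fun j : Fin (n₁ + n₂) => (j : ℕ) < n₁), (M i j) ^ 2) +
      (∑ i ∈ Finset.univ.filter (fun i : Fin (n₁ + n₂) => n₁ ≤ (i : ℕ)),
        ∑ j ∈ Finset.univ.filter (fun j : Fin (n₁ + n₂) => n₁ ≤ (j : ℕ)), (M i j) ^ 2)) := by
  have key : ∀ f : Fin (n₁ + n₂) → ℝ, ∑ i, f i =
      (∑ i ∈ Finset.univ.filter (fun i : Fin (n₁ + n₂) => (i : ℕ) < n₁), f i) +
      ∑ i ∈ Finset.univ.filter (fun i : Fin (n₁ + n₂) => n₁ ≤ (i : ℕ)), f i := by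
    intro f
    rw [← Finset.sum_filter_add_sum_filter_not Finset.univ
      (fun i : Fin (n₁ + n₂) => (i : ℕ) < n₁) f]
    simp only [not_lt]
  have hsw : (∑ i ∈ Finset.univ.filter (fun i : Fin (n₁ + n₂) => n₁ ≤ (i : ℕ)),
        ∑ j ∈ Finset.univ.filter (fun j : Fin (n₁ + n₂) => (j : ℕ) < n₁), (M i j) ^ 2) =
      ∑ i ∈ Finset.univ.filter (fun i : Fin (n₁ + n₂) => (i : ℕ) < n₁),
        ∑ j ∈ Finset.univ.filter (fun j : Fin (n₁ + n₂) => n₁ ≤ (j : ℕ)), (M i j) ^ 2 := by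
    rw [Finset.sum_comm]
    refine Finset.sum_congr rfl fun i _ => Finset.sum_congr rfl fun j _ => ?_
    rw [hM.apply]
  rw [key]
  simp_rw [key (fun j => (M _ j) ^ 2)]
  rw [Finset.sum_add_distrib, Finset.sum_add_distrib, hsw]
  ring

/-- The algebraic core of Theorem 5.1 of the paper: for symmetric matrices `h^r`
(components of the second fundamental form in an adapted orthonormal frame) whose
partial trace over the first `n₁` indices vanishes (`N_T`-minimality),
`Σ_r Σ_{i<n₁} Σ_{j≥n₁} (h^r_{ii} h^r_{jj} - (h^r_{ij})²) = -Σ_r Σ_{i<n₁} Σ_{j≥n₁} (h^r_{ij})²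
  ≥ -(1/2) Σ_r Σ_{i,j} (h^r_{ij})²`,
with equality iff both diagonal blocks of every `h^r` vanish. -/
theorem partial_trace_free_inequality (n₁ n₂ k : ℕ)
    (h : Fin k → Matrix (Fin (n₁ + n₂)) (Fin (n₁ + n₂)) ℝ)
    (hsymm : ∀ r, (h r).IsSymm)
    (htrace : ∀ r, ∑ i ∈ Finset.univ.filter (fun i : Fin (n₁ + n₂) => (i : ℕ) < n₁),
        h r i i = 0) :
    (∑ r : Fin k, ∑ i ∈ Finset.univ.filter (fun i : Fin (n₁ + n₂) => (i : ℕ) < n₁),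
        ∑ j ∈ Finset.univ.filter (fun j : Fin (n₁ + n₂) => n₁ ≤ (j : ℕ)),
          (h r i i * h r j j - (h r i j) ^ 2) =
      - ∑ r : Fin k, ∑ i ∈ Finset.univ.filter (fun i : Fin (n₁ + n₂) => (i : ℕ) < n₁),
          ∑ j ∈ Finset.univ.filter (fun j : Fin (n₁ + n₂) => n₁ ≤ (j : ℕ)),
            (h r i j) ^ 2) ∧
    (- ∑ r : Fin k, ∑ i ∈ Finset.univ.filter (fun i : Fin (n₁ + n₂) => (i : ℕ) < n₁),
          ∑ j ∈ Finset.univ.filter (fun j : Fin (n₁ + n₂) => n₁ ≤ (j : ℕ)),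
            (h r i j) ^ 2 ≥
      -(1 / 2) * ∑ r : Fin k, ∑ i : Fin (n₁ + n₂), ∑ j : Fin (n₁ + n₂), (h r i j) ^ 2) ∧
    ((- ∑ r : Fin k, ∑ i ∈ Finset.univ.filter (fun i : Fin (n₁ + n₂) => (i : ℕ) < n₁),
          ∑ j ∈ Finset.univ.filter (fun j : Fin (n₁ + n₂) => n₁ ≤ (j : ℕ)),
            (h r i j) ^ 2 =
        -(1 / 2) * ∑ r : Fin k, ∑ i : Fin (n₁ + n₂), ∑ j : Fin (n₁ + n₂), (h r i j) ^ 2) ↔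
      (∀ r : Fin k,
        (∀ i j : Fin (n₁ + n₂), (i : ℕ) < n₁ → (j : ℕ) < n₁ → h r i j = 0) ∧
        (∀ i j : Fin (n₁ + n₂), n₁ ≤ (i : ℕ) → n₁ ≤ (j : ℕ) → h r i j = 0))) := by
  have htot : ∑ r : Fin k, ∑ i : Fin (n₁ + n₂), ∑ j : Fin (n₁ + n₂), (h r i j) ^ 2 = _ :=
    Finset.sum_congr rfl fun r _ => block_split n₁ n₂ (h r) (hsymm r)
  rw [Finset.sum_add_distrib, ← Finset.mul_sum] at htot
  have hD : ∀ r, r ∈ (Finset.univ : Finset (Fin k)) → 0 ≤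
      (∑ i ∈ Finset.univ.filter (fun i : Fin (n₁ + n₂) => (i : ℕ) < n₁),
        ∑ j ∈ Finset.univ.filter (fun j : Fin (n₁ + n₂) => (j : ℕ) < n₁), (h r i j) ^ 2) +
      (∑ i ∈ Finset.univ.filter (fun i : Fin (n₁ + n₂) => n₁ ≤ (i : ℕ)),
        ∑ j ∈ Finset.univ.filter (fun j : Fin (n₁ + n₂) => n₁ ≤ (j : ℕ)), (h r i j) ^ 2) := by
    intro r _
    positivity
  have hD0 := Finset.sum_nonneg hD
  have hz := Finset.sum_eq_zero_iff_of_nonneg hD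
  have hblock : ∀ (r : Fin k) (s : Finset (Fin (n₁ + n₂))),
      ∑ i ∈ s, ∑ j ∈ s, (h r i j) ^ 2 = 0 ↔ ∀ i ∈ s, ∀ j ∈ s, h r i j = 0 := by
    intro r s
    rw [Finset.sum_eq_zero_iff_of_nonneg (fun i _ => by positivity)]
    refine forall₂_congr fun i _ => ?_
    rw [Finset.sum_eq_zero_iff_of_nonneg (fun i _ => by positivity)]
    simp
  refine ⟨?_, ?_, ?_⟩
  · rw [← Finset.sum_neg_distrib]
    refine Finset.sum_congr rfl fun r _ => ?_
    simp only [Finset.sum_sub_distrib, ← Finset.mul_sum]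
    rw [← Finset.sum_mul, htrace r]
    ring
  · rw [htot]
    linarith
  · rw [htot]
    constructor
    · intro heq r
      have h1 := hz.1 (by linarith) r (Finset.mem_univ r)
      rw [add_eq_zero_iff_of_nonneg (by positivity) (by positivity), hblock, hblock] at h1
      exact ⟨fun i j hi hj => h1.1 i (by simpa using hi) j (by simpa using hj),
        fun i j hi hj => h1.2 i (by simpa using hi) j (by simpa using hj)⟩
    · intro H
      have h1 := hz.2 (fun r _ => by
        rw [add_eq_zero_iff_of_nonneg (by positivity) (by positivity), hblock, hblock]
        exact ⟨fun i hi j hj => (H r).1 i j (by simpa using hi) (by simpa using hj),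
          fun i hi j hj => (H r).2 i j (by simpa using hi) (by simpa using hj)⟩)
      linarith
end

section
/- Let s, q ≥ 1 be integers, θ ∈ (0, π/2), α, β ∈ ℝ, and a₁, …, a_s, b₁, …, b_s ∈ ℝ. Let E be a real inner product space with an orthonormal system {e₁, …, e_s, f₁, …, f_s, ξ, z₁, …, z_q, z̄₁, …, z̄_q} forming a basis of E (so dim E = n = 2s + 1 + 2q), let W be a real inner product space containing an orthonormal system {w₁, …, w_q, w̄₁, …, w̄_q}, and let h : E × E → W be a symmetric bilinear map. Assume, for all admissible indices i, j: ⟨h(e_i, z_j), w_j⟩ = −csc θ · b_i, ⟨h(f_i, z_j), w_j⟩ = csc θ · a_i, ⟨h(e_i, z̄_j), w̄_j⟩ = −csc θ · b_i, ⟨h(f_i, z̄_j), w̄_j⟩ = csc θ · a_i, ⟨h(e_i, z_j), w̄_j⟩ = (1/3) cot θ · a_i, ⟨h(f_i, z_j), w̄_j⟩ = (1/3) cot θ · b_i, ⟨h(e_i, z̄_j), w_j⟩ = −(1/3) cot θ · a_i, ⟨h(f_i, z̄_j), w_j⟩ = −(1/3) cot θ · b_i, ⟨h(ξ, z_j), w_j⟩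 = −α csc θ, and ⟨h(ξ, z̄_j), w̄_j⟩ = −α csc θ. Define ‖h‖² := Σ_{u,v} ‖h(u, v)‖²_W, the double sum running over all ordered pairs of vectors from the orthonormal basis of E, and set D := Σ_{i=1}^{s} (a_i² + b_i²). Then ‖h‖² ≥ 2q [ ( (2/9) cot²θ + 2 csc²θ ) · D + α² ]. -/
open scoped RealInnerProductSpace

/-- The algebraic core of Theorem 4.1 of the paper, the main inequality
`‖h‖² ≥ 2q[((2/9)cot²θ + 2csc²θ)(‖grad(ln f)‖² - β²) + α²]` for warped product
semi-slant submanifolds `N_T ×_f N_θ` of a nearly trans-Sasakian manifold of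
type `(α, β)`: here `{e_i, f_i, ξ}` is the adapted frame of the invariant factor,
`{z_j, z̄_j}` that of the slant factor, `{w_j, w̄_j}` the orthonormal frame of
`F D_θ`, the listed inner products are those furnished by Lemma 3.2 (iii)-(v),
`a_i, b_i` are the components of `grad(ln f)`, and `D = Σ(a_i² + b_i²)`. -/
theorem warped_product_second_fundamental_form_inequality
    {E W : Type*} [NormedAddCommGroup E] [InnerProductSpace ℝ E]
    [NormedAddCommGroup W] [InnerProductSpace ℝ W]
    (s q : ℕ) (hs : 1 ≤ s) (hq : 1 ≤ q)
    (θ : ℝ) (hθ : θ ∈ Set.Ioo 0 (Real.pi / 2))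
    (α β : ℝ) (a b : Fin s → ℝ)
    (e f : Fin s → E) (ξ : E) (z zbar : Fin q → E)
    (bas : Fin s ⊕ Fin s ⊕ Unit ⊕ Fin q ⊕ Fin q → E)
    (hbas : bas = Sum.elim e (Sum.elim f (Sum.elim (fun _ : Unit => ξ) (Sum.elim z zbar))))
    (hONE : Orthonormal ℝ bas)
    (hspan : Submodule.span ℝ (Set.range bas) = ⊤)
    (w wbar : Fin q → W)
    (hONW : Orthonormal ℝ (Sum.elim w wbar))
    (h : E →ₗ[ℝ] E →ₗ[ℝ] W) (hsymm : ∀ x y, h x y = h y x)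
    (h1 : ∀ (i : Fin s) (j : Fin q), ⟪h (e i) (z j), w j⟫ = -((Real.sin θ)⁻¹ * b i))
    (h2 : ∀ (i : Fin s) (j : Fin q), ⟪h (f i) (z j), w j⟫ = (Real.sin θ)⁻¹ * a i)
    (h3 : ∀ (i : Fin s) (j : Fin q), ⟪h (e i) (zbar j), wbar j⟫ = -((Real.sin θ)⁻¹ * b i))
    (h4 : ∀ (i : Fin s) (j : Fin q), ⟪h (f i) (zbar j), wbar j⟫ = (Real.sin θ)⁻¹ * a i)
    (h5 : ∀ (i : Fin s) (j : Fin q),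
      ⟪h (e i) (z j), wbar j⟫ = (1 / 3) * (Real.cos θ / Real.sin θ) * a i)
    (h6 : ∀ (i : Fin s) (j : Fin q),
      ⟪h (f i) (z j), wbar j⟫ = (1 / 3) * (Real.cos θ / Real.sin θ) * b i)
    (h7 : ∀ (i : Fin s) (j : Fin q),
      ⟪h (e i) (zbar j), w j⟫ = -((1 / 3) * (Real.cos θ / Real.sin θ) * a i))
    (h8 : ∀ (i : Fin s) (j : Fin q),
      ⟪h (f i) (zbar j), w j⟫ = -((1 / 3) * (Real.cos θ / Real.sin θ) * b i))
    (h9 : ∀ j : Fin q, ⟪h ξ (z j), w j⟫ = -(α * (Real.sin θ)⁻¹))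
    (h10 : ∀ j : Fin q, ⟪h ξ (zbar j), wbar j⟫ = -(α * (Real.sin θ)⁻¹)) :
    ∑ u, ∑ v, ‖h (bas u) (bas v)‖ ^ 2 ≥
      2 * q * (((2 / 9) * (Real.cos θ / Real.sin θ) ^ 2 + 2 * ((Real.sin θ)⁻¹) ^ 2) *
          (∑ i : Fin s, (a i ^ 2 + b i ^ 2)) + α ^ 2) := by
  have bes : ∀ (x : W) (j : Fin q), ⟪x, w j⟫ ^ 2 + ⟪x, wbar j⟫ ^ 2 ≤ ‖x‖ ^ 2 := by
    intro x j
    have hb := hONW.sum_inner_products_le (s := {Sum.inl j, Sum.inr j}) x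
    rw [Finset.sum_pair (by simp)] at hb
    simpa [real_inner_comm] using hb
  have hsin : 0 < Real.sin θ :=
    Real.sin_pos_of_pos_of_lt_pi hθ.1 (by linarith [hθ.2, Real.pi_pos])
  have hc : 1 ≤ ((Real.sin θ)⁻¹) ^ 2 :=
    one_le_pow₀ ((one_le_inv₀ hsin).2 (Real.sin_le_one θ))
  subst hbas
  set c := (Real.sin θ)⁻¹ with hcdef
  set k := Real.cos θ / Real.sin θ with hk
  have key : ∀ (x : Fin s → E) (y : Fin q → E) (B : Fin s → ℝ),
      (∀ i j, B i ≤ ‖h (x i) (y j)‖ ^ 2) →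
      q * ∑ i, B i ≤ ∑ i, ∑ j, ‖h (x i) (y j)‖ ^ 2 := by
    intro x y B hB
    rw [Finset.mul_sum]
    refine Finset.sum_le_sum fun i _ => ?_
    have := Finset.sum_le_sum (s := (Finset.univ : Finset (Fin q))) fun j _ => hB i j
    simpa using this
  have keyx : ∀ (y : Fin q → E), (∀ j, α ^ 2 ≤ ‖h ξ (y j)‖ ^ 2) →
      q * α ^ 2 ≤ ∑ j, ‖h ξ (y j)‖ ^ 2 := by
    intro y hB
    have := Finset.sum_le_sum (s := (Finset.univ : Finset (Fin q))) fun j _ => hB j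
    simpa using this
  have comm : ∀ (x : Fin s → E) (y : Fin q → E),
      ∑ j, ∑ i, ‖h (y j) (x i)‖ ^ 2 = ∑ i, ∑ j, ‖h (x i) (y j)‖ ^ 2 := by
    intro x y
    rw [Finset.sum_comm]
    simp only [hsymm]
  have commx : ∀ (y : Fin q → E), ∑ j, ‖h (y j) ξ‖ ^ 2 = ∑ j, ‖h ξ (y j)‖ ^ 2 := by
    intro y
    exact Finset.sum_congr rfl fun j _ => by rw [hsymm]
  have hα : α ^ 2 ≤ (-(α * c)) ^ 2 := by nlinarith [sq_nonneg α]
  have k1 := key e z (fun i => c ^ 2 * b i ^ 2 + 1 / 9 * k ^ 2 * a i ^ 2) (fun i j => by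
    have := bes (h (e i) (z j)) j
    rw [h1, h5] at this; linarith)
  have k2 := key e zbar (fun i => c ^ 2 * b i ^ 2 + 1 / 9 * k ^ 2 * a i ^ 2) (fun i j => by
    have := bes (h (e i) (zbar j)) j
    rw [h3, h7] at this; linarith)
  have k3 := key f z (fun i => c ^ 2 * a i ^ 2 + 1 / 9 * k ^ 2 * b i ^ 2) (fun i j => by
    have := bes (h (f i) (z j)) j
    rw [h2, h6] at this; linarith)
  have k4 := key f zbar (fun i => c ^ 2 * a i ^ 2 + 1 / 9 * k ^ 2 * b i ^ 2) (fun i j => by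
    have := bes (h (f i) (zbar j)) j
    rw [h4, h8] at this; linarith)
  have x1 := keyx z (fun j => by
    have := bes (h ξ (z j)) j
    rw [h9] at this; nlinarith [sq_nonneg ⟪h ξ (z j), wbar j⟫])
  have x2 := keyx zbar (fun j => by
    have := bes (h ξ (zbar j)) j
    rw [h10] at this; nlinarith [sq_nonneg ⟪h ξ (zbar j), w j⟫])
  simp only [Finset.sum_add_distrib, ← Finset.mul_sum] at k1 k2 k3 k4
  simp only [Fintype.sum_sum_type, Sum.elim_inl, Sum.elim_inr, Finset.sum_add_distrib,
    Finset.univ_unique, Finset.sum_singleton, comm, commx]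
  have nn : ∀ {m n : ℕ} (x : Fin m → E) (y : Fin n → E),
      0 ≤ ∑ i, ∑ j, ‖h (x i) (y j)‖ ^ 2 := fun x y => by positivity
  have n1 : ∀ {m : ℕ} (x : Fin m → E), 0 ≤ ∑ i, ‖h (x i) ξ‖ ^ 2 := fun x => by positivity
  have n2 : ∀ {m : ℕ} (x : Fin m → E), 0 ≤ ∑ i, ‖h ξ (x i)‖ ^ 2 := fun x => by positivity
  have n3 : 0 ≤ ‖h ξ ξ‖ ^ 2 := by positivity
  have n4 : 0 ≤ (q : ℝ) * α ^ 2 := by positivity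
  linarith [nn e e, nn e f, nn f e, nn f f, nn z z, nn z zbar, nn zbar z, nn zbar zbar,
    n1 e, n1 f, n2 e, n2 f]
end
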